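/- For every ρ ∈ (0,1), one has e^{−2π²}/(4π² + 1) · ρ^{−1/2} ≤ Σ_{k=1}^∞ exp(−2k²π²ρ) ≤ 1/(12ρ). -/

import Mathlib

open Real

/-- The Basel series, indexed from zero. -/
lemma hasSum_one_div_add_one_sq :
    HasSum (fun k : ℕ => 1 / ((k : ℝ) + 1) ^ 2) (π ^ 2 / 6) := by
  have h := (hasSum_nat_add_iff' (f := fun n : ℕ => 1 / (n : ℝ) ^ 2) 1).mpr hasSum_zeta_two
  simpa using h

lemma exp_neg_le_one_div {x : ℝ} (hx : 0 < x) : exp (-x) ≤ 1 / x := by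
  rw [exp_neg, ← one_div]
  exact one_div_le_one_div_of_le hx (by linarith [add_one_le_exp x])

lemma exp_trace_term_le {ρ : ℝ} (hρ : 0 < ρ) (k : ℕ) :
    exp (-2 * ((k : ℝ) + 1) ^ 2 * π ^ 2 * ρ) ≤
      1 / (2 * π ^ 2 * ρ) * (1 / ((k : ℝ) + 1) ^ 2) := by
  have h := exp_neg_le_one_div (x := 2 * ((k : ℝ) + 1) ^ 2 * π ^ 2 * ρ) (by positivity)
  calc exp (-2 * ((k : ℝ) + 1) ^ 2 * π ^ 2 * ρ)
      = exp (-(2 * ((k : ℝ) + 1) ^ 2 * π ^ 2 * ρ)) := by ring_nf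
    _ ≤ 1 / (2 * ((k : ℝ) + 1) ^ 2 * π ^ 2 * ρ) := h
    _ = 1 / (2 * π ^ 2 * ρ) * (1 / ((k : ℝ) + 1) ^ 2) := by field_simp

lemma summable_exp_trace_term {ρ : ℝ} (hρ : 0 < ρ) :
    Summable fun k : ℕ => exp (-2 * ((k : ℝ) + 1) ^ 2 * π ^ 2 * ρ) :=
  Summable.of_nonneg_of_le (fun _ => (exp_pos _).le) (exp_trace_term_le hρ)
    (hasSum_one_div_add_one_sq.summable.mul_left _)

/-- The terms with `(k + 1) * √ρ ≤ 1` are each at least `exp (-2 * π ^ 2)`. -/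
lemma floor_mul_exp_le_tsum {ρ : ℝ} (hρ : 0 < ρ) :
    (⌊(√ρ)⁻¹⌋₊ : ℝ) * exp (-2 * π ^ 2) ≤
      ∑' k : ℕ, exp (-2 * ((k : ℝ) + 1) ^ 2 * π ^ 2 * ρ) := by
  have hs : 0 < √ρ := sqrt_pos.mpr hρ
  refine le_trans ?_ ((summable_exp_trace_term hρ).sum_le_tsum (Finset.range ⌊(√ρ)⁻¹⌋₊)
    fun _ _ => (exp_pos _).le)
  rw [← nsmul_eq_mul]
  nth_rewrite 1 [← Finset.card_range ⌊(√ρ)⁻¹⌋₊]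
  refine Finset.card_nsmul_le_sum _ _ _ fun k hk => exp_le_exp.mpr ?_
  have hk' : (k : ℝ) + 1 ≤ (√ρ)⁻¹ := by
    have := (Nat.le_floor_iff (inv_pos.mpr hs).le).mp (Finset.mem_range.mp hk)
    push_cast at this
    exact this
  have hmul : ((k : ℝ) + 1) * √ρ ≤ 1 := by
    rwa [← le_div_iff₀ hs, one_div]
  have hsq : ((k : ℝ) + 1) ^ 2 * ρ ≤ 1 := by
    calc ((k : ℝ) + 1) ^ 2 * ρ = (((k : ℝ) + 1) * √ρ) ^ 2 := by
          rw [mul_pow, sq_sqrt hρ.le]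
      _ ≤ 1 := pow_le_one₀ (by positivity) hmul
  nlinarith [mul_le_mul_of_nonneg_left hsq (sq_nonneg π)]

/-- Two-sided bound on the trace Σ_{k=1}^∞ e^{−2k²π²ρ} of the covariance operator Q_ρ. -/
theorem trace_bounds (ρ : ℝ) (hρ : ρ ∈ Set.Ioo (0 : ℝ) 1) :
    Real.exp (-2 * π ^ 2) / (4 * π ^ 2 + 1) * (ρ ^ ((1 : ℝ) / 2))⁻¹ ≤
      ∑' k : ℕ, Real.exp (-2 * ((k : ℝ) + 1) ^ 2 * π ^ 2 * ρ) ∧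
    ∑' k : ℕ, Real.exp (-2 * ((k : ℝ) + 1) ^ 2 * π ^ 2 * ρ) ≤ 1 / (12 * ρ) := by
  obtain ⟨h0, h1⟩ := hρ
  constructor
  · refine le_trans ?_ (floor_mul_exp_le_tsum h0)
    rw [← sqrt_eq_rpow, div_mul_eq_mul_div, div_le_iff₀ (by positivity)]
    have hone : 1 ≤ (√ρ)⁻¹ :=
      (one_le_inv₀ (sqrt_pos.mpr h0)).mpr (sqrt_le_one.mpr h1.le)
    have hfloor : (1 : ℝ) ≤ ⌊(√ρ)⁻¹⌋₊ := by
      exact_mod_cast Nat.one_le_floor_iff _ |>.mpr hone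
    have hlt := Nat.lt_floor_add_one (√ρ)⁻¹
    have hinv : (√ρ)⁻¹ ≤ ⌊(√ρ)⁻¹⌋₊ * (4 * π ^ 2 + 1) := by
      nlinarith [pi_gt_three]
    calc exp (-2 * π ^ 2) * (√ρ)⁻¹
        ≤ exp (-2 * π ^ 2) * (⌊(√ρ)⁻¹⌋₊ * (4 * π ^ 2 + 1)) := by gcongr
      _ = ⌊(√ρ)⁻¹⌋₊ * exp (-2 * π ^ 2) * (4 * π ^ 2 + 1) := by ring
  · have hsum := hasSum_one_div_add_one_sq.mul_left (1 / (2 * π ^ 2 * ρ))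
    calc ∑' k : ℕ, exp (-2 * ((k : ℝ) + 1) ^ 2 * π ^ 2 * ρ)
        ≤ 1 / (2 * π ^ 2 * ρ) * (π ^ 2 / 6) :=
          hasSum_le (exp_trace_term_le h0) (summable_exp_trace_term h0).hasSum hsum
      _ = 1 / (12 * ρ) := by
          field_simp
          norm_num
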